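/- The special linear group SL₂(𝔽₃) of 2×2 matrices of determinant 1 over the field with 3 elements is not (1 | 2,2)-generated; that is, there do not exist elements ℓ₁, ℓ₂, h₁, h₂ ∈ SL₂(𝔽₃) with ℓ₁ and ℓ₂ of order 2, ℓ₁ℓ₂ · h₁h₂h₁⁻¹h₂⁻¹ = 1, and {ℓ₁, ℓ₂, h₁, h₂} generating SL₂(𝔽₃). -/

import Mathlib

/-- The only element of order two in `SL₂(𝔽₃)` is `-1`. -/
lemma SL2F3_eq_neg_one (g : Matrix.SpecialLinearGroup (Fin 2) (ZMod 3))
    (hg : orderOf g = 2) : g = -1 := by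
  have h2 : g ^ 2 = 1 := orderOf_dvd_iff_pow_eq_one.1 (by rw [hg])
  have h1 : g ≠ 1 := by
    rintro rfl
    simp at hg
  have key : ∀ a b c d : ZMod 3, a * d - b * c = 1 → a * a + b * c = 1 → a * b + b * d = 0 →
      c * a + d * c = 0 → c * b + d * d = 1 →
      (a = 1 ∧ b = 0 ∧ c = 0 ∧ d = 1) ∨ (a = -1 ∧ b = 0 ∧ c = 0 ∧ d = -1) := by decide
  have hd := g.det_coe
  rw [Matrix.det_fin_two] at hd
  have hm : g.1 * g.1 = 1 := by
    have := congrArg Subtype.val h2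
    simpa [pow_two] using this
  have e := fun i j => congrFun (congrFun hm i) j
  have e00 := e 0 0
  have e01 := e 0 1
  have e10 := e 1 0
  have e11 := e 1 1
  simp [Matrix.mul_apply, Fin.sum_univ_two] at e00 e01 e10 e11
  rcases key _ _ _ _ hd e00 e01 e10 e11 with ⟨ha, hb, hc, hdd⟩ | ⟨ha, hb, hc, hdd⟩
  · exfalso
    apply h1
    ext i j
    fin_cases i <;> fin_cases j <;> simp [ha, hb, hc, hdd]
  · ext i j
    fin_cases i <;> fin_cases j <;> simp [ha, hb, hc, hdd]

/-- `SL₂(𝔽₃)` is not `(1 | 2,2)`-generated. -/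
theorem SL2F3_not_one_two_two_generated :
    ¬ ∃ l₁ l₂ h₁ h₂ : Matrix.SpecialLinearGroup (Fin 2) (ZMod 3),
        orderOf l₁ = 2 ∧ orderOf l₂ = 2 ∧
        l₁ * l₂ * (h₁ * h₂ * h₁⁻¹ * h₂⁻¹) = 1 ∧
        Subgroup.closure
          ({l₁, l₂, h₁, h₂} : Set (Matrix.SpecialLinearGroup (Fin 2) (ZMod 3))) = ⊤ := by
  rintro ⟨l₁, l₂, h₁, h₂, o1, o2, hrel, hgen⟩
  obtain rfl := SL2F3_eq_neg_one l₁ o1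
  obtain rfl := SL2F3_eq_neg_one l₂ o2
  have hc : h₁ * h₂ = h₂ * h₁ := by
    have h : h₁ * h₂ * h₁⁻¹ * h₂⁻¹ = 1 := by simpa using hrel
    rw [mul_inv_eq_one, mul_inv_eq_iff_eq_mul] at h
    exact h
  have hcomm : ∀ x ∈ ({-1, -1, h₁, h₂} : Set (Matrix.SpecialLinearGroup (Fin 2) (ZMod 3))),
      ∀ y ∈ ({-1, -1, h₁, h₂} : Set (Matrix.SpecialLinearGroup (Fin 2) (ZMod 3))),
      x * y = y * x := by
    rintro x (rfl | rfl | rfl | rfl) y (rfl | rfl | rfl | rfl) <;> simp [hc]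
  have s1 : ∀ g, ∀ x ∈ ({-1, -1, h₁, h₂} : Set (Matrix.SpecialLinearGroup (Fin 2) (ZMod 3))),
      x * g = g * x := by
    intro g
    have hle := (Subgroup.closure_le (Subgroup.centralizer
      ({-1, -1, h₁, h₂} : Set (Matrix.SpecialLinearGroup (Fin 2) (ZMod 3))))).2
      (fun x hx => Subgroup.mem_centralizer_iff.2 fun y hy => hcomm y hy x hx)
    rw [hgen] at hle
    exact Subgroup.mem_centralizer_iff.1 (hle (Subgroup.mem_top g))
  have s2 : ∀ g k : Matrix.SpecialLinearGroup (Fin 2) (ZMod 3), k * g = g * k := by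
    intro g k
    have hle := (Subgroup.closure_le (Subgroup.center
      (Matrix.SpecialLinearGroup (Fin 2) (ZMod 3)))).2
      (fun x hx => Subgroup.mem_center_iff.2 fun y => (s1 y x hx).symm)
    rw [hgen] at hle
    exact Subgroup.mem_center_iff.1 (hle (Subgroup.mem_top g)) k
  have h := s2 ⟨!![1, 1; 0, 1], by simp [Matrix.det_fin_two]⟩
    ⟨!![1, 0; 1, 1], by simp [Matrix.det_fin_two]⟩
  have h' := congrFun (congrFun (congrArg Subtype.val h) 0) 0
  revert h'
  decide
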